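/- Let R be a finite set, let B be a real R×R matrix with zero diagonal, let X ⊆ R with a, b ∈ X, and let η ∈ ℝ satisfy η ≥ 1 and η ≥ Σ_{y∈R∖{x}} |B_{x,y}| for every x ∈ R. Then |det_{ab}^{(X)}(−B_{X×X})| ≤ η^{|X|−1}, where B_{X×X} is the submatrix of B indexed by X. -/

import Mathlib

open Finset

noncomputable section

/-- The `(b,a)` cofactor of the `X × X` submatrix of `M` (real version). -/
def cofDetR {α : Type*} [Fintype α] [DecidableEq α]
    (X : Finset α) (M : Matrix α α ℝ) (a b : α) : ℝ :=
  (Matrix.of fun x y : X => if (x : α) = b then (if (y : α) = a then (1:ℝ) else 0)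
    else (if (y : α) = a then 0 else M x y)).det

/-- A determinant is bounded by the product of the `ℓ¹` norms of the rows. -/
theorem abs_det_le_prod_sum {n : Type*} [Fintype n] [DecidableEq n] (M : Matrix n n ℝ) :
    |M.det| ≤ ∏ i, ∑ j, |M i j| := by
  rw [← Matrix.det_transpose, Matrix.det_apply, Finset.prod_univ_sum]
  refine (Finset.abs_sum_le_sum_abs _ _).trans ?_
  have h1 : ∀ σ : Equiv.Perm n,
      |Equiv.Perm.sign σ • ∏ i, M.transpose (σ i) i| = ∏ i, |M i (σ i)| := by
    intro σ
    rcases Int.units_eq_one_or (Equiv.Perm.sign σ) with h | h <;>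
      simp [h, Finset.abs_prod]
  simp only [h1]
  have h2 : ∑ σ : Equiv.Perm n, ∏ i, |M i (σ i)|
      = ∑ p ∈ (Finset.univ : Finset (Equiv.Perm n)).map
          ⟨fun (σ : Equiv.Perm n) => (σ : n → n), DFunLike.coe_injective⟩, ∏ i, |M i (p i)| := by
    rw [Finset.sum_map]
    rfl
  rw [h2]
  refine Finset.sum_le_sum_of_subset_of_nonneg ?_ ?_
  · intro p _
    simp
  · intro p _ _
    exact Finset.prod_nonneg fun i _ => abs_nonneg _

/-- **Hadamard bound for the cofactors (proof of Lemma 3.4).** If `B` has zero diagonal,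
`η ≥ 1` and `η ≥ Σ_{y≠x} |B_{x,y}|` for every `x`, then for every `X ⊆ R` with
`a, b ∈ X`, `|det_{ab}^{(X)}(−B_{X×X})| ≤ η^{|X|−1}`. -/
theorem cofDet_hadamard_bound
    {R : Type*} [Fintype R] [DecidableEq R]
    (B : Matrix R R ℝ) (hBdiag : ∀ x, B x x = 0)
    (X : Finset R) (a b : R) (ha : a ∈ X) (hb : b ∈ X)
    (η : ℝ) (hη1 : 1 ≤ η)
    (hη2 : ∀ x : R, ∑ y ∈ Finset.univ \ {x}, |B x y| ≤ η) :
    |cofDetR X (-B) a b| ≤ η ^ (X.card - 1) := by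
  unfold cofDetR
  refine (abs_det_le_prod_sum _).trans ?_
  have hX : X.card - 1 = ((Finset.univ : Finset X).erase ⟨b, hb⟩).card := by
    rw [Finset.card_erase_of_mem (Finset.mem_univ _)]
    simp
  rw [hX, ← Finset.mul_prod_erase _ _ (Finset.mem_univ (⟨b, hb⟩ : X))]
  have hrow : ∑ j : X, |(Matrix.of fun x y : X => if (x : R) = b then
      (if (y : R) = a then (1:ℝ) else 0)
      else (if (y : R) = a then 0 else (-B) x y)) ⟨b, hb⟩ j| = 1 := by
    rw [Finset.sum_eq_single (⟨a, ha⟩ : X)]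
    · simp
    · intro j _ hj
      have : (j : R) ≠ a := fun h => hj (Subtype.ext h)
      simp [this]
    · simp
  rw [hrow, one_mul]
  rw [← Finset.prod_const]
  refine Finset.prod_le_prod (fun i _ => Finset.sum_nonneg fun j _ => abs_nonneg _) ?_
  intro i hi
  have hib : (i : R) ≠ b := fun h => (Finset.mem_erase.mp hi).1 (Subtype.ext h)
  have hall : ∑ y, |B i y| ≤ η := by
    have := hη2 i
    rwa [Finset.sum_sdiff_eq_sub (Finset.subset_univ _), Finset.sum_singleton, hBdiag,
      abs_zero, sub_zero] at this
  refine le_trans ?_ hall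
  calc _ ≤ ∑ j : X, |B i j| := by
        refine Finset.sum_le_sum fun j _ => ?_
        by_cases hj : (j : R) = a <;> simp [hib, hj]
    _ = ∑ y ∈ X, |B i y| := Finset.sum_coe_sort X (fun y => |B i y|)
    _ ≤ _ := Finset.sum_le_sum_of_subset_of_nonneg (Finset.subset_univ _)
        fun _ _ _ => abs_nonneg _

end
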